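/- arXiv:2501.08093 — 3 statements merged into one kernel-verified Lean document; each statement's English description precedes it below -/
import Mathlib

section
/- For the standardized Student t density g(z; ν) with ν > 0, the cross integral appearing in the scale–shape Fisher information satisfies ∫_ℝ z · (∂g/∂z)(z; ν) · (∂g/∂ν)(z; ν) / g(z; ν) dz = 2 / {(ν + 1)(ν + 3)}. -/
open MeasureTheory

/-- The density of the standardized Student `t`-distribution with `ν` degrees of
freedom: `g(z;ν) = Γ((ν+1)/2)/(√(νπ) Γ(ν/2)) (1 + z²/ν)^{−(ν+1)/2}`. -/
noncomputable def studentPdf (ν z : ℝ) : ℝ :=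
  Real.Gamma ((ν + 1) / 2) / (Real.sqrt (ν * Real.pi) * Real.Gamma (ν / 2)) *
    (1 + z ^ 2 / ν) ^ (-((ν + 1) / 2))

lemma integrable_one_add_sq_rpow_neg {s : ℝ} (hs : 1 / 2 < s) :
    Integrable (fun x : ℝ => (1 + x ^ 2) ^ (-s)) := by
  have h := integrable_rpow_neg_one_add_norm_sq (E := ℝ) (μ := volume) (r := 2 * s)
    (by simp; linarith)
  refine h.congr (Filter.Eventually.of_forall fun x => ?_)
  simp only [Real.norm_eq_abs, sq_abs]
  congr 1
  ring

/-- The unnormalized Student integral `∫ (1 + x²)^{-s} dx`. -/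
noncomputable def studentIntegral (s : ℝ) : ℝ := ∫ x : ℝ, (1 + x ^ 2) ^ (-s)

/-- The derivative of `studentIntegral`, as an integral. -/
noncomputable def studentLogIntegral (s : ℝ) : ℝ :=
  ∫ x : ℝ, -Real.log (1 + x ^ 2) * (1 + x ^ 2) ^ (-s)

/-- Evaluation by writing `Γ(s) (1 + x²)^{-s} = ∫ t^{s-1} e^{-(1+x²)t} dt` and
integrating first in `x`. -/
lemma studentIntegral_eq_Gamma {s : ℝ} (hs : 1 / 2 < s) :
    studentIntegral s = √Real.pi * Real.Gamma (s - 1 / 2) / Real.Gamma s := by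
  have hs0 : 0 < s := by linarith
  set f : ℝ → ℝ → ℝ := fun x t => t ^ (s - 1) * Real.exp (-((1 + x ^ 2) * t)) with hf
  have hsplit : ∀ x t, f x t = t ^ (s - 1) * Real.exp (-t) * Real.exp (-t * x ^ 2) := by
    intro x t
    simp only [hf]
    rw [mul_assoc, ← Real.exp_add]
    ring_nf
  have hinner : ∀ t ∈ Set.Ioi (0 : ℝ),
      ∫ x, f x t = √Real.pi * (Real.exp (-t) * t ^ (s - 1 / 2 - 1)) := by
    intro t ht
    have ht : 0 < t := ht
    simp_rw [hsplit]
    rw [integral_const_mul, integral_gaussian, Real.sqrt_div Real.pi_pos.le,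
      show s - 1 / 2 - 1 = (s - 1) - 1 / 2 by ring, Real.rpow_sub ht (s - 1), ← Real.sqrt_eq_rpow]
    ring
  have hconv : Integrable (fun t => √Real.pi * (Real.exp (-t) * t ^ (s - 1 / 2 - 1)))
      (volume.restrict (Set.Ioi 0)) :=
    (Real.GammaIntegral_convergent (by linarith : 0 < s - 1 / 2)).const_mul _
  have hint : Integrable (Function.uncurry f)
      ((volume : Measure ℝ).prod (volume.restrict (Set.Ioi 0))) := by
    have hmeas : Measurable (Function.uncurry f) := by
      simp only [hf, Function.uncurry_def]
      fun_prop
    refine (integrable_prod_iff' hmeas.aestronglyMeasurable).2 ⟨?_, ?_⟩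
    · refine (ae_restrict_iff' measurableSet_Ioi).2 (Filter.Eventually.of_forall fun t ht => ?_)
      simp only [Function.uncurry_apply_pair, hsplit]
      exact (integrable_exp_neg_mul_sq ht).const_mul _
    · refine hconv.congr ((ae_restrict_iff' measurableSet_Ioi).2
        (Filter.Eventually.of_forall fun t ht => ?_))
      have ht' : 0 < t := ht
      simp only [Function.uncurry_apply_pair]
      rw [← hinner t ht]
      refine integral_congr_ae (Filter.Eventually.of_forall fun x => ?_)
      simp only [hf]
      rw [Real.norm_of_nonneg (by positivity)]
  have hswap := integral_integral_swap hint
  have hleft : ∀ x : ℝ, ∫ t in Set.Ioi 0, f x t = (1 + x ^ 2) ^ (-s) * Real.Gamma s := by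
    intro x
    have hx : 0 < 1 + x ^ 2 := by positivity
    simp only [hf]
    rw [Real.integral_rpow_mul_exp_neg_mul_Ioi hs0 hx, one_div,
      Real.inv_rpow hx.le, Real.rpow_neg hx.le]
  simp_rw [hleft] at hswap
  rw [integral_mul_const, setIntegral_congr_fun measurableSet_Ioi hinner, integral_const_mul,
    ← Real.Gamma_eq_integral (by linarith)] at hswap
  rw [eq_div_iff (Real.Gamma_pos_of_pos hs0).ne', ← hswap, studentIntegral]

lemma studentIntegral_pos {s : ℝ} (hs : 1 / 2 < s) : 0 < studentIntegral s := by
  rw [studentIntegral_eq_Gamma hs]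
  have h1 := Real.Gamma_pos_of_pos (by linarith : 0 < s - 1 / 2)
  have h2 := Real.Gamma_pos_of_pos (by linarith : 0 < s)
  positivity

lemma studentIntegral_add_one {s : ℝ} (hs : 1 / 2 < s) :
    studentIntegral (s + 1) = (s - 1 / 2) / s * studentIntegral s := by
  have hs0 : s ≠ 0 := by linarith
  have hG := (Real.Gamma_pos_of_pos (by linarith : 0 < s)).ne'
  rw [studentIntegral_eq_Gamma hs, studentIntegral_eq_Gamma (by linarith),
    show s + 1 - 1 / 2 = (s - 1 / 2) + 1 by ring, Real.Gamma_add_one (by linarith),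
    Real.Gamma_add_one hs0]
  field_simp

lemma integrable_log_and_hasDerivAt_studentIntegral {s : ℝ} (hs : 1 / 2 < s) :
    Integrable (fun x : ℝ => -Real.log (1 + x ^ 2) * (1 + x ^ 2) ^ (-s)) ∧
      HasDerivAt studentIntegral (studentLogIntegral s) s := by
  obtain ⟨δ, hδ, hsδ⟩ : ∃ δ : ℝ, 0 < δ ∧ 1 / 2 < s - δ - δ :=
    ⟨(s - 1 / 2) / 4, by linarith, by linarith⟩
  refine hasDerivAt_integral_of_dominated_loc_of_deriv_le
    (F := fun s (x : ℝ) => (1 + x ^ 2) ^ (-s))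
    (F' := fun s (x : ℝ) => -Real.log (1 + x ^ 2) * (1 + x ^ 2) ^ (-s))
    (bound := fun x => (1 + x ^ 2) ^ (-(s - δ - δ)) / δ)
    (Metric.ball_mem_nhds s hδ) ?_ (integrable_one_add_sq_rpow_neg hs) ?_ ?_
    ((integrable_one_add_sq_rpow_neg hsδ).div_const δ) ?_
  · exact Filter.Eventually.of_forall fun r =>
      (show Measurable fun x : ℝ => (1 + x ^ 2) ^ (-r) by fun_prop).aestronglyMeasurable
  · exact (show Measurable fun x : ℝ => -Real.log (1 + x ^ 2) * (1 + x ^ 2) ^ (-s) by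
      fun_prop).aestronglyMeasurable
  · refine Filter.Eventually.of_forall fun x r hr => ?_
    have hu : 1 ≤ 1 + x ^ 2 := by nlinarith [sq_nonneg x]
    have hu0 : 0 < 1 + x ^ 2 := by linarith
    rw [Metric.mem_ball, Real.dist_eq, abs_lt] at hr
    have hlog := Real.log_nonneg hu
    rw [norm_mul, norm_neg, Real.norm_of_nonneg hlog, Real.norm_of_nonneg (by positivity)]
    calc Real.log (1 + x ^ 2) * (1 + x ^ 2) ^ (-r)
        ≤ ((1 + x ^ 2) ^ δ / δ) * (1 + x ^ 2) ^ (-(s - δ)) := by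
          gcongr
          · exact Real.log_le_rpow_div hu0.le hδ
          · linarith
      _ = (1 + x ^ 2) ^ (-(s - δ - δ)) / δ := by
          rw [div_mul_eq_mul_div, ← Real.rpow_add hu0]
          ring_nf
  · refine Filter.Eventually.of_forall fun x r _ => ?_
    have h := (hasDerivAt_neg r).const_rpow (a := 1 + x ^ 2) (by positivity)
    exact h.congr_deriv (by ring)

lemma studentLogIntegral_add_one {s : ℝ} (hs : 1 / 2 < s) :
    studentLogIntegral (s + 1) =
      (s - 1 / 2) / s * studentLogIntegral s + studentIntegral s / (2 * s ^ 2) := by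
  have hs0 : s ≠ 0 := by linarith
  have h1 := (integrable_log_and_hasDerivAt_studentIntegral
    (by linarith : 1 / 2 < s + 1)).2.comp_add_const s 1
  have h2 := (((hasDerivAt_id s).sub_const (1 / 2)).div (hasDerivAt_id s) hs0).mul
    (integrable_log_and_hasDerivAt_studentIntegral hs).2
  have heq : (fun r => studentIntegral (r + 1)) =ᶠ[nhds s]
      fun r => (r - 1 / 2) / r * studentIntegral r := by
    filter_upwards [lt_mem_nhds hs] with r hr using studentIntegral_add_one hr
  rw [h1.unique (h2.congr_of_eventuallyEq heq)]
  simp only [id, Pi.div_apply]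
  field_simp
  ring

lemma studentPdf_eq {m : ℝ} (hm : 0 < m) (z : ℝ) :
    studentPdf m z =
      (√m * studentIntegral ((m + 1) / 2))⁻¹ * (1 + z ^ 2 / m) ^ (-((m + 1) / 2)) := by
  have h1 := (Real.Gamma_pos_of_pos (by linarith : 0 < m / 2)).ne'
  have h2 := (Real.Gamma_pos_of_pos (by linarith : 0 < (m + 1) / 2)).ne'
  rw [studentPdf, studentIntegral_eq_Gamma (by linarith), Real.sqrt_mul hm.le,
    show (m + 1) / 2 - 1 / 2 = m / 2 by ring]
  field_simp

lemma hasDerivAt_studentPdf_arg {ν : ℝ} (hν : 0 < ν) (z : ℝ) :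
    HasDerivAt (fun w => studentPdf ν w)
      (-((ν + 1) * z / (ν * (1 + z ^ 2 / ν))) * studentPdf ν z) z := by
  have hu : 0 < 1 + z ^ 2 / ν := by positivity
  have hd : HasDerivAt (fun w : ℝ => 1 + w ^ 2 / ν) (2 * z / ν) z := by
    simpa using ((hasDerivAt_pow 2 z).div_const ν).const_add 1
  have h := (hd.rpow_const (p := -((ν + 1) / 2)) (Or.inl hu.ne')).const_mul
    (Real.Gamma ((ν + 1) / 2) / (√(ν * Real.pi) * Real.Gamma (ν / 2)))
  refine h.congr_deriv ?_
  rw [Real.rpow_sub_one hu.ne', studentPdf]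
  field_simp

lemma hasDerivAt_studentPdf_shape {ν : ℝ} (hν : 0 < ν) (z : ℝ) :
    HasDerivAt (fun m => studentPdf m z)
      ((-1 / (2 * ν) - studentLogIntegral ((ν + 1) / 2) / (2 * studentIntegral ((ν + 1) / 2))
        - Real.log (1 + z ^ 2 / ν) / 2
        + (ν + 1) / 2 * (z ^ 2 / ν ^ 2) / (1 + z ^ 2 / ν)) * studentPdf ν z) ν := by
  have hu : 0 < 1 + z ^ 2 / ν := by positivity
  have hs : 1 / 2 < (ν + 1) / 2 := by linarith
  have hJ := studentIntegral_pos hs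
  have hsq := Real.sqrt_pos.2 hν
  have hhalf : HasDerivAt (fun m : ℝ => (m + 1) / 2) (1 / 2) ν :=
    ((hasDerivAt_id ν).add_const 1).div_const 2
  have hdJ : HasDerivAt (fun m => studentIntegral ((m + 1) / 2))
      (studentLogIntegral ((ν + 1) / 2) * (1 / 2)) ν :=
    HasDerivAt.comp (h₂ := studentIntegral) ν
      (integrable_log_and_hasDerivAt_studentIntegral hs).2 hhalf
  have hconst := ((Real.hasDerivAt_sqrt hν.ne').mul hdJ).inv (mul_pos hsq hJ).ne'
  have hbase : HasDerivAt (fun m : ℝ => 1 + z ^ 2 / m) (-(z ^ 2 / ν ^ 2)) ν := by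
    have := ((hasDerivAt_inv hν.ne').const_mul (z ^ 2)).const_add 1
    simpa [div_eq_mul_inv] using this
  have h := hconst.mul (hbase.rpow hhalf.neg hu)
  have heq : (fun m => studentPdf m z) =ᶠ[nhds ν] fun m =>
      (√m * studentIntegral ((m + 1) / 2))⁻¹ * (1 + z ^ 2 / m) ^ (-((m + 1) / 2)) := by
    filter_upwards [lt_mem_nhds hν] with m hm using studentPdf_eq hm z
  refine (h.congr_of_eventuallyEq heq).congr_deriv ?_
  rw [studentPdf_eq hν]
  simp only [Pi.mul_apply, Pi.inv_apply, Pi.neg_apply]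
  rw [Real.rpow_sub_one hu.ne']
  generalize (1 + z ^ 2 / ν) ^ (-((ν + 1) / 2)) = P
  generalize Real.log (1 + z ^ 2 / ν) = l
  generalize studentIntegral ((ν + 1) / 2) = J at *
  generalize studentLogIntegral ((ν + 1) / 2) = D
  obtain ⟨q, hq, rfl⟩ : ∃ q : ℝ, 0 < q ∧ ν = q ^ 2 := ⟨√ν, hsq, (Real.sq_sqrt hν.le).symm⟩
  rw [Real.sqrt_sq hq.le]
  field_simp
  ring

/-- For the standardized Student `t` density, the cross integral appearing in the
scale–shape Fisher information satisfies
`∫ z (∂g/∂z)(z;ν)(∂g/∂ν)(z;ν)/g(z;ν) dz = 2/((ν+1)(ν+3))`. -/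
theorem stmt8 (ν : ℝ) (hν : 0 < ν) :
    ∫ z : ℝ, z * deriv (fun w => studentPdf ν w) z *
        deriv (fun m => studentPdf m z) ν / studentPdf ν z
      = 2 / ((ν + 1) * (ν + 3)) := by
  have hq := Real.sqrt_pos.2 hν
  set s := (ν + 1) / 2 with hsdef
  have hs : 1 / 2 < s := by rw [hsdef]; linarith
  have hJ := studentIntegral_pos hs
  set c := -1 / (2 * ν) - studentLogIntegral s / (2 * studentIntegral s) with hc
  set F : ℝ → ℝ := fun x => -(2 * s) * (√ν * studentIntegral s)⁻¹ *
    (c * ((1 + x ^ 2) ^ (-s) - (1 + x ^ 2) ^ (-(s + 1)))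
      + 1 / 2 * (-Real.log (1 + x ^ 2) * (1 + x ^ 2) ^ (-s)
        - -Real.log (1 + x ^ 2) * (1 + x ^ 2) ^ (-(s + 1)))
      + s / ν * ((1 + x ^ 2) ^ (-s) - 2 * (1 + x ^ 2) ^ (-(s + 1))
        + (1 + x ^ 2) ^ (-(s + 1 + 1)))) with hF
  have hpoint : ∀ z : ℝ, z * deriv (fun w => studentPdf ν w) z *
      deriv (fun m => studentPdf m z) ν / studentPdf ν z = F (z / √ν) := by
    intro z
    have hu : 0 < 1 + z ^ 2 / ν := by positivity
    have hP := Real.rpow_pos_of_pos hu (-s)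
    rw [(hasDerivAt_studentPdf_arg hν z).deriv, (hasDerivAt_studentPdf_shape hν z).deriv]
    simp only [hF, div_pow, Real.sq_sqrt hν.le]
    rw [studentPdf_eq hν, ← hsdef, ← hc, show -(s + 1 + 1) = -s - 1 - 1 by ring,
      show -(s + 1) = -s - 1 by ring, show ν + 1 = 2 * s by rw [hsdef]; ring]
    simp only [Real.rpow_sub_one hu.ne']
    generalize (1 + z ^ 2 / ν) ^ (-s) = P at *
    generalize Real.log (1 + z ^ 2 / ν) = l
    generalize studentIntegral s = J at *
    clear_value c s
    field_simp
    ring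
  have hI0 := integrable_one_add_sq_rpow_neg hs
  have hI1 := integrable_one_add_sq_rpow_neg (by linarith : 1 / 2 < s + 1)
  have hI2 := integrable_one_add_sq_rpow_neg (by linarith : 1 / 2 < s + 1 + 1)
  have hL0 := (integrable_log_and_hasDerivAt_studentIntegral hs).1
  have hL1 := (integrable_log_and_hasDerivAt_studentIntegral (by linarith : 1 / 2 < s + 1)).1
  have hFint : ∫ x, F x = -(2 * s) * (√ν * studentIntegral s)⁻¹ *
      (c * (studentIntegral s - studentIntegral (s + 1))
        + 1 / 2 * (studentLogIntegral s - studentLogIntegral (s + 1))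
        + s / ν * (studentIntegral s - 2 * studentIntegral (s + 1)
          + studentIntegral (s + 1 + 1))) := by
    simp only [hF]
    rw [integral_const_mul, integral_add, integral_add, integral_const_mul, integral_const_mul,
      integral_const_mul, integral_sub hI0 hI1, integral_sub hL0 hL1, integral_add,
      integral_sub hI0 (hI1.const_mul 2), integral_const_mul]
    · rfl
    · exact hI0.sub (hI1.const_mul 2)
    · exact hI2
    · exact (hI0.sub hI1).const_mul c
    · exact (hL0.sub hL1).const_mul _
    · exact ((hI0.sub hI1).const_mul c).add ((hL0.sub hL1).const_mul _)
    · exact ((hI0.sub (hI1.const_mul 2)).add hI2).const_mul _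
  simp_rw [hpoint]
  rw [Measure.integral_comp_div, hFint, abs_of_pos hq, smul_eq_mul,
    studentIntegral_add_one (by linarith : 1 / 2 < s + 1), studentIntegral_add_one hs,
    studentLogIntegral_add_one hs, hc]
  clear hpoint hFint hF hc hI0 hI1 hI2 hL0 hL1 F c
  clear_value s
  generalize studentIntegral s = J at *
  generalize studentLogIntegral s = D
  have hs1 : s + 1 ≠ 0 := by linarith
  have hs0 : s ≠ 0 := by linarith
  obtain rfl : ν = 2 * s - 1 := by rw [hsdef]; ring
  have hν' := hν.ne'
  rw [show 2 * s - 1 + 1 = 2 * s by ring, show 2 * s - 1 + 3 = 2 * (s + 1) by ring]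
  field_simp
  ring
end

section
/- Let f̄(x; μ, λ, ν) = f(x; μ, λν/(ν+1), ν) be the location-scale t density in the orthogonal parameterization λ = σ(ν+1)/ν, and write ℓ̄ = log f̄. Then for all μ ∈ ℝ, λ > 0, ν > 0, the Fisher information matrix of (μ, λ, ν) is diagonal: ∫_ℝ (∂ℓ̄/∂μ)(∂ℓ̄/∂λ) f̄ dx = 0, ∫_ℝ (∂ℓ̄/∂μ)(∂ℓ̄/∂ν) f̄ dx = 0, and ∫_ℝ (∂ℓ̄/∂λ)(∂ℓ̄/∂ν) f̄ dx = 0; that is, μ, λ, and ν are totally (globally) orthogonal parameters. -/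
open MeasureTheory

/-- The location-scale `t` density
`f(x; μ, σ, ν) = Γ((ν+1)/2)/(σ√(νπ) Γ(ν/2)) {1 + (x−μ)²/(νσ²)}^{−(ν+1)/2}`. -/
noncomputable def lstPdf (μ σ ν x : ℝ) : ℝ :=
  Real.Gamma ((ν + 1) / 2) / (σ * Real.sqrt (ν * Real.pi) * Real.Gamma (ν / 2)) *
    (1 + (x - μ) ^ 2 / (ν * σ ^ 2)) ^ (-((ν + 1) / 2))

/-- The location-scale `t` density in the orthogonal parameterization
`λ = σ(ν+1)/ν`, i.e. `f̄(x; μ, λ, ν) = f(x; μ, λν/(ν+1), ν)`. -/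
noncomputable def lstPdfBar (μ lam ν x : ℝ) : ℝ :=
  lstPdf μ (lam * ν / (ν + 1)) ν x

open Filter Topology

theorem integral_eq_zero_of_reflect_eq_neg {F : ℝ → ℝ} {c : ℝ} (h : ∀ x, F (c - x) = -F x) :
    ∫ x, F x = 0 := by
  have h₁ : ∫ x, F (c - x) = ∫ x, F x := integral_sub_left_eq_self F volume c
  simp only [h, integral_neg] at h₁
  linarith

theorem lstPdfBar_reflect (μ lam ν x : ℝ) :
    lstPdfBar μ lam ν (2 * μ - x) = lstPdfBar μ lam ν x := by
  unfold lstPdfBar lstPdf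
  rw [show (2 * μ - x - μ) ^ 2 = (x - μ) ^ 2 by ring]

theorem deriv_log_lstPdfBar_loc_reflect (μ lam ν x : ℝ) :
    deriv (fun m => Real.log (lstPdfBar m lam ν (2 * μ - x))) μ =
      -deriv (fun m => Real.log (lstPdfBar m lam ν x)) μ := by
  have h : (fun m => Real.log (lstPdfBar m lam ν (2 * μ - x))) =
      fun m => Real.log (lstPdfBar (2 * μ - m) lam ν x) := by
    funext m
    unfold lstPdfBar lstPdf
    rw [show (2 * μ - x - m) ^ 2 = (x - (2 * μ - m)) ^ 2 by ring]
  rw [h, deriv_comp_const_sub (fun m => Real.log (lstPdfBar m lam ν x))]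
  congr 2
  ring

/-- The squared scale `ν σ²`, with `σ = λν/(ν+1)`, of the kernel of the density. -/
noncomputable def kernelScale (lam ν : ℝ) : ℝ := ν * (lam * ν / (ν + 1)) ^ 2

theorem kernelScale_pos {lam ν : ℝ} (hlam : 0 < lam) (hν : 0 < ν) : 0 < kernelScale lam ν := by
  unfold kernelScale
  positivity

/-- The normalizing constant of the density. -/
noncomputable def normConst (lam ν : ℝ) : ℝ :=
  Real.Gamma ((ν + 1) / 2) /
    (lam * ν / (ν + 1) * Real.sqrt (ν * Real.pi) * Real.Gamma (ν / 2))

theorem normConst_pos {lam ν : ℝ} (hlam : 0 < lam) (hν : 0 < ν) : 0 < normConst lam ν := by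
  unfold normConst
  have := Real.Gamma_pos_of_pos (show 0 < (ν + 1) / 2 by positivity)
  have := Real.Gamma_pos_of_pos (show 0 < ν / 2 by positivity)
  positivity

theorem lstPdfBar_eq (μ lam ν x : ℝ) :
    lstPdfBar μ lam ν x = normConst lam ν *
      (1 + (x - μ) ^ 2 / kernelScale lam ν) ^ (-((ν + 1) / 2)) := rfl

theorem kernel_pos {a : ℝ} (ha : 0 < a) (s : ℝ) : 0 < 1 + s ^ 2 / a := by positivity

theorem log_lstPdfBar (μ x : ℝ) {lam ν : ℝ} (hlam : 0 < lam) (hν : 0 < ν) :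
    Real.log (lstPdfBar μ lam ν x) = Real.log (normConst lam ν) -
      (ν + 1) / 2 * Real.log (1 + (x - μ) ^ 2 / kernelScale lam ν) := by
  have hw := kernel_pos (kernelScale_pos hlam hν) (x - μ)
  rw [lstPdfBar_eq, Real.log_mul (normConst_pos hlam hν).ne' (Real.rpow_pos_of_pos hw _).ne',
    Real.log_rpow hw]
  ring

theorem hasDerivAt_kernelScale_lam {lam ν : ℝ} (hlam : 0 < lam) :
    HasDerivAt (fun L => kernelScale L ν) (2 / lam * kernelScale lam ν) lam := by
  unfold kernelScale
  have h := (((((hasDerivAt_id lam).mul_const ν).div_const (ν + 1)).pow 2).const_mul ν)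
  refine h.congr_deriv ?_
  simp
  field_simp

theorem hasDerivAt_kernelScale_nu {lam ν : ℝ} (hν : 0 < ν) :
    HasDerivAt (fun n => kernelScale lam n)
      ((ν + 3) / (ν * (ν + 1)) * kernelScale lam ν) ν := by
  unfold kernelScale
  have hν1 : ν + 1 ≠ 0 := by positivity
  have h := (hasDerivAt_id ν).mul
    (((((hasDerivAt_id ν).const_mul lam).div ((hasDerivAt_id ν).add_const 1) hν1)).pow 2)
  refine h.congr_deriv ?_
  simp
  field_simp
  ring

theorem hasDerivAt_log_kernel {a : ℝ → ℝ} {r t : ℝ} (s : ℝ) (ha : 0 < a t)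
    (h : HasDerivAt a (r * a t) t) :
    HasDerivAt (fun u => Real.log (1 + s ^ 2 / a u)) (-r * (1 - (1 + s ^ 2 / a t)⁻¹)) t := by
  have hw := kernel_pos ha s
  have h₁ := (((hasDerivAt_const t (s ^ 2)).div h ha.ne').const_add 1).log hw.ne'
  refine h₁.congr_deriv ?_
  have : a t + s ^ 2 ≠ 0 := by positivity
  simp
  field_simp
  ring

theorem hasDerivAt_log_normConst_lam {lam ν : ℝ} (hlam : 0 < lam) (hν : 0 < ν) :
    HasDerivAt (fun L => Real.log (normConst L ν)) (-1 / lam) lam := by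
  have h₁ := (Real.hasDerivAt_log hlam.ne').const_sub (Real.log (normConst 1 ν))
  refine (h₁.congr_deriv (by ring)).congr_of_eventuallyEq ?_
  filter_upwards [lt_mem_nhds hlam] with L hL
  rw [← Real.log_div (normConst_pos one_pos hν).ne' hL.ne']
  congr 1
  unfold normConst
  field_simp

theorem differentiableAt_log_normConst_nu {lam ν : ℝ} (hlam : 0 < lam) (hν : 0 < ν) :
    DifferentiableAt ℝ (fun n => Real.log (normConst lam n)) ν := by
  refine DifferentiableAt.log ?_ (normConst_pos hlam hν).ne'
  have hΓ : ∀ t : ℝ, 0 < t → DifferentiableAt ℝ Real.Gamma t := fun t ht =>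
    Real.differentiableAt_Gamma fun m => by
      have : (0 : ℝ) ≤ m := m.cast_nonneg
      linarith
  have h₁ : DifferentiableAt ℝ (fun n : ℝ => Real.Gamma ((n + 1) / 2)) ν :=
    DifferentiableAt.comp (g := Real.Gamma) ν (hΓ _ (by positivity)) (by fun_prop)
  have h₂ : DifferentiableAt ℝ (fun n : ℝ => Real.Gamma (n / 2)) ν :=
    DifferentiableAt.comp (g := Real.Gamma) ν (hΓ _ (by positivity)) (by fun_prop)
  have h₃ : DifferentiableAt ℝ (fun n : ℝ => Real.sqrt (n * Real.pi)) ν :=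
    DifferentiableAt.sqrt (by fun_prop) (by positivity)
  have h₄ : DifferentiableAt ℝ (fun n : ℝ => lam * n / (n + 1)) ν :=
    DifferentiableAt.div (by fun_prop) (by fun_prop) (by positivity)
  have := Real.Gamma_pos_of_pos (show 0 < ν / 2 by positivity)
  exact h₁.div ((h₄.mul h₃).mul h₂) (by positivity)

theorem deriv_log_lstPdfBar_lam (μ x : ℝ) {lam ν : ℝ} (hlam : 0 < lam) (hν : 0 < ν) :
    deriv (fun L => Real.log (lstPdfBar μ L ν x)) lam =
      (ν - (ν + 1) * (1 + (x - μ) ^ 2 / kernelScale lam ν)⁻¹) / lam := by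
  have h := (hasDerivAt_log_normConst_lam hlam hν).sub
    ((hasDerivAt_log_kernel (a := fun L => kernelScale L ν) (x - μ) (kernelScale_pos hlam hν)
      (hasDerivAt_kernelScale_lam hlam)).const_mul ((ν + 1) / 2))
  have he : (fun L => Real.log (lstPdfBar μ L ν x)) =ᶠ[𝓝 lam] fun L =>
      Real.log (normConst L ν) -
        (ν + 1) / 2 * Real.log (1 + (x - μ) ^ 2 / kernelScale L ν) := by
    filter_upwards [lt_mem_nhds hlam] with L hL using log_lstPdfBar μ x hL hν
  rw [(h.congr_of_eventuallyEq he).deriv]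
  ring

theorem exists_deriv_log_lstPdfBar_nu (μ : ℝ) {lam ν : ℝ} (hlam : 0 < lam) (hν : 0 < ν) :
    ∃ C : ℝ, ∀ x, deriv (fun n => Real.log (lstPdfBar μ lam n x)) ν =
      C - Real.log (1 + (x - μ) ^ 2 / kernelScale lam ν) / 2 -
        (ν + 3) / (2 * ν) * (1 + (x - μ) ^ 2 / kernelScale lam ν)⁻¹ := by
  refine ⟨deriv (fun n => Real.log (normConst lam n)) ν + (ν + 3) / (2 * ν), fun x => ?_⟩
  have h := (differentiableAt_log_normConst_nu hlam hν).hasDerivAt.sub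
    ((((hasDerivAt_id ν).add_const 1).div_const 2).mul
      (hasDerivAt_log_kernel (x - μ) (kernelScale_pos hlam hν)
        (hasDerivAt_kernelScale_nu hν)))
  have he : (fun n => Real.log (lstPdfBar μ lam n x)) =ᶠ[𝓝 ν] fun n =>
      Real.log (normConst lam n) -
        (n + 1) / 2 * Real.log (1 + (x - μ) ^ 2 / kernelScale lam n) := by
    filter_upwards [lt_mem_nhds hν] with n hn using log_lstPdfBar μ x hlam hn
  rw [(h.congr_of_eventuallyEq he).deriv]
  generalize (1 + (x - μ) ^ 2 / kernelScale lam ν) = w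
  simp only [id]
  field_simp
  ring

/-- An antiderivative, up to constants, of the product of the `λ`- and `ν`-scores with the
density, as a function of the centred variable. -/
noncomputable def scorePrimitive (A D p a s : ℝ) : ℝ :=
  s * (1 + s ^ 2 / a) ^ (-p) * (A + Real.log (1 + s ^ 2 / a) / 2 + D * (1 + s ^ 2 / a)⁻¹)

theorem hasDerivAt_scorePrimitive {ν a : ℝ} (hν : 0 < ν) (ha : 0 < a) (C s : ℝ) :
    HasDerivAt (scorePrimitive (1 / ν - C) ((ν + 1) / (2 * ν)) ((ν + 1) / 2) a)
      ((ν - (ν + 1) * (1 + s ^ 2 / a)⁻¹) *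
        (C - Real.log (1 + s ^ 2 / a) / 2 - (ν + 3) / (2 * ν) * (1 + s ^ 2 / a)⁻¹) *
          (1 + s ^ 2 / a) ^ (-((ν + 1) / 2))) s := by
  have hw := kernel_pos ha s
  have h₁ : HasDerivAt (fun s : ℝ => 1 + s ^ 2 / a) (2 * s / a) s :=
    ((((hasDerivAt_id s).pow 2).div_const a).const_add 1).congr_deriv (by simp)
  have h := ((hasDerivAt_id s).mul (h₁.rpow_const (p := -((ν + 1) / 2)) (Or.inl hw.ne'))).mul
    ((((h₁.log hw.ne').div_const 2).const_add (1 / ν - C)).add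
      ((h₁.inv hw.ne').const_mul ((ν + 1) / (2 * ν))))
  refine h.congr_deriv ?_
  have hs : s ^ 2 = a * ((1 + s ^ 2 / a) - 1) := by field_simp; ring
  simp only [id, Pi.add_apply, Pi.mul_apply, Pi.inv_apply, Real.rpow_sub_one hw.ne']
  generalize Real.log (1 + s ^ 2 / a) = l
  generalize (1 + s ^ 2 / a) ^ (-((ν + 1) / 2)) = P
  generalize 1 + s ^ 2 / a = w at *
  field_simp
  ring_nf
  simp only [hs]
  ring

theorem tendsto_scorePrimitive {ν a : ℝ} (hν : 0 < ν) (ha : 0 < a) (A D : ℝ) {l : Filter ℝ}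
    (hl : Tendsto (fun s : ℝ => s ^ 2) l atTop) :
    Tendsto (scorePrimitive A D ((ν + 1) / 2) a) l (𝓝 0) := by
  have hw : Tendsto (fun s : ℝ => 1 + s ^ 2 / a) l atTop :=
    tendsto_atTop_add_const_left _ _ (hl.atTop_div_const ha)
  have h₁ : Tendsto (fun w : ℝ => w ^ (-(ν / 2))) atTop (𝓝 0) :=
    tendsto_rpow_neg_atTop (by positivity)
  have h₂ : Tendsto (fun w : ℝ => w ^ (-(ν / 2)) * Real.log w) atTop (𝓝 0) := by
    refine ((isLittleO_log_rpow_atTop (half_pos hν)).tendsto_div_nhds_zero).congr' ?_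
    filter_upwards [eventually_gt_atTop 0] with w hw
    rw [Real.rpow_neg hw.le]
    ring
  have h₃ : Tendsto (fun w : ℝ => w ^ (-(ν / 2)) * (A + Real.log w / 2 + D * w⁻¹))
      atTop (𝓝 0) := by
    have := ((h₁.const_mul A).add (h₂.div_const 2)).add
      ((h₁.mul tendsto_inv_atTop_zero).const_mul D)
    refine (this.congr fun w => ?_).trans (by simp)
    ring
  have h₄ : Tendsto (fun s => Real.sqrt a * ‖(1 + s ^ 2 / a) ^ (-(ν / 2)) *
      (A + Real.log (1 + s ^ 2 / a) / 2 + D * (1 + s ^ 2 / a)⁻¹)‖) l (𝓝 0) := by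
    simpa using ((h₃.comp hw).norm.const_mul (Real.sqrt a))
  refine squeeze_zero_norm (fun s => ?_) h₄
  have hws := kernel_pos ha s
  have hs : |s| ≤ Real.sqrt a * (1 + s ^ 2 / a) ^ (1 / 2 : ℝ) := by
    rw [← Real.sqrt_eq_rpow, ← Real.sqrt_mul ha.le]
    refine Real.abs_le_sqrt ?_
    rw [mul_add, mul_div_cancel₀ _ ha.ne']
    linarith
  have hp : (1 + s ^ 2 / a) ^ (-(ν / 2)) =
      (1 + s ^ 2 / a) ^ (1 / 2 : ℝ) * (1 + s ^ 2 / a) ^ (-((ν + 1) / 2)) := by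
    rw [← Real.rpow_add hws]
    congr 1
    ring
  unfold scorePrimitive
  rw [hp, norm_mul, norm_mul, norm_mul, norm_mul, Real.norm_eq_abs s,
    Real.norm_of_nonneg (Real.rpow_nonneg hws.le (1 / 2)), ← mul_assoc, ← mul_assoc]
  gcongr

theorem integral_scoreLam_mul_scoreNu_eq_zero (μ : ℝ) {lam ν : ℝ} (hlam : 0 < lam)
    (hν : 0 < ν) :
    ∫ x : ℝ, deriv (fun L => Real.log (lstPdfBar μ L ν x)) lam *
        deriv (fun n => Real.log (lstPdfBar μ lam n x)) ν * lstPdfBar μ lam ν x = 0 := by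
  obtain ⟨C, hC⟩ := exists_deriv_log_lstPdfBar_nu μ hlam hν
  have ha := kernelScale_pos hlam hν
  simp only [deriv_log_lstPdfBar_lam μ _ hlam hν, hC]
  simp only [lstPdfBar_eq]
  set a := kernelScale lam ν
  rw [integral_sub_right_eq_self (fun s : ℝ => (ν - (ν + 1) * (1 + s ^ 2 / a)⁻¹) / lam *
    (C - Real.log (1 + s ^ 2 / a) / 2 - (ν + 3) / (2 * ν) * (1 + s ^ 2 / a)⁻¹) *
      (normConst lam ν * (1 + s ^ 2 / a) ^ (-((ν + 1) / 2)))) μ]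
  by_cases hi : Integrable fun s : ℝ => (ν - (ν + 1) * (1 + s ^ 2 / a)⁻¹) / lam *
    (C - Real.log (1 + s ^ 2 / a) / 2 - (ν + 3) / (2 * ν) * (1 + s ^ 2 / a)⁻¹) *
      (normConst lam ν * (1 + s ^ 2 / a) ^ (-((ν + 1) / 2)))
  · have hlim : ∀ {l : Filter ℝ}, Tendsto (fun s : ℝ => s ^ 2) l atTop →
        Tendsto (fun s => normConst lam ν / lam *
          scorePrimitive (1 / ν - C) ((ν + 1) / (2 * ν)) ((ν + 1) / 2) a s) l (𝓝 0) :=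
      fun hl => by simpa using (tendsto_scorePrimitive hν ha _ _ hl).const_mul _
    rw [integral_of_hasDerivAt_of_tendsto (fun s =>
      ((hasDerivAt_scorePrimitive hν ha C s).const_mul (normConst lam ν / lam)).congr_deriv
        (by ring)) hi (hlim ?_) (hlim (tendsto_pow_atTop two_ne_zero)), sub_zero]
    simpa [Function.comp_def] using
      (tendsto_pow_atTop (α := ℝ) two_ne_zero).comp tendsto_neg_atBot_atTop
  · exact integral_undef hi

/-- In the orthogonal parameterization `λ = σ(ν+1)/ν`, the Fisher information matrix
of `(μ, λ, ν)` for the location-scale `t`-distribution is diagonal: `μ`, `λ` and `ν`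
are totally (globally) orthogonal parameters. -/
theorem stmt10 (μ lam ν : ℝ) (hlam : 0 < lam) (hν : 0 < ν) :
    (∫ x : ℝ, deriv (fun m => Real.log (lstPdfBar m lam ν x)) μ *
        deriv (fun L => Real.log (lstPdfBar μ L ν x)) lam * lstPdfBar μ lam ν x = 0) ∧
    (∫ x : ℝ, deriv (fun m => Real.log (lstPdfBar m lam ν x)) μ *
        deriv (fun n => Real.log (lstPdfBar μ lam n x)) ν * lstPdfBar μ lam ν x = 0) ∧
    (∫ x : ℝ, deriv (fun L => Real.log (lstPdfBar μ L ν x)) lam *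
        deriv (fun n => Real.log (lstPdfBar μ lam n x)) ν * lstPdfBar μ lam ν x = 0) := by
  refine ⟨?_, ?_, integral_scoreLam_mul_scoreNu_eq_zero μ hlam hν⟩
  · refine integral_eq_zero_of_reflect_eq_neg (c := 2 * μ) fun x => ?_
    simp only [lstPdfBar_reflect μ, deriv_log_lstPdfBar_loc_reflect]
    ring
  · refine integral_eq_zero_of_reflect_eq_neg (c := 2 * μ) fun x => ?_
    simp only [lstPdfBar_reflect μ, deriv_log_lstPdfBar_loc_reflect]
    ring
end

section
/- Let X1 and X2 be independent with X_i having the Gamma density f(x_i; α_i, θ) = x_i^{α_i−1} e^{−x_i/θ}/(Γ(α_i) θ^{α_i}), x_i > 0, sharing the scale θ > 0. Reparameterize θ = λ/(α1 + α2) with λ > 0, and let ℓ̄(α1, α2, λ; x1, x2) = log f(x1; α1, λ/(α1+α2)) + log f(x2; α2, λ/(α1+α2)) be the joint log-likelihood in (α1, α2, λ). Then for all α1, α2, λ > 0 and i = 1, 2: ∫_0^∞ ∫_0^∞ (∂ℓ̄/∂α_i)(∂ℓ̄/∂λ) e^{ℓ̄} dx1 dx2 = 0; that is, the reparameterization λ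 = θ(α1 + α2) makes the shape parameters α1 and α2 globally orthogonal to λ. -/
open MeasureTheory

/-- The Gamma density with shape `α` and scale `θ`:
`f(x; α, θ) = x^{α−1} e^{−x/θ}/(Γ(α) θ^α)`, `x > 0`. -/
noncomputable def gammaScalePdf (α θ x : ℝ) : ℝ :=
  x ^ (α - 1) * Real.exp (-x / θ) / (Real.Gamma α * θ ^ α)

/-- The joint log-likelihood of two independent Gamma observations sharing the scale,
in the reparameterization `θ = λ/(α₁+α₂)`. -/
noncomputable def gammaLbar (α₁ α₂ lam x₁ x₂ : ℝ) : ℝ :=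
  Real.log (gammaScalePdf α₁ (lam / (α₁ + α₂)) x₁) +
    Real.log (gammaScalePdf α₂ (lam / (α₁ + α₂)) x₂)

open Filter Topology Set

lemma gammaScalePdf_pos {α θ x : ℝ} (hα : 0 < α) (hθ : 0 < θ) (hx : 0 < x) :
    0 < gammaScalePdf α θ x := by
  have := Real.Gamma_pos_of_pos hα
  unfold gammaScalePdf
  positivity

lemma gammaScalePdf_eq_const_mul (α θ x : ℝ) :
    gammaScalePdf α θ x =
      (Real.Gamma α * θ ^ α)⁻¹ * (x ^ (α - 1) * Real.exp (-(θ⁻¹ * x))) := by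
  rw [gammaScalePdf, div_eq_inv_mul, neg_div, div_eq_inv_mul x θ]

lemma mul_gammaScalePdf {α θ x : ℝ} (hα : 0 < α) (hθ : 0 < θ) (hx : 0 < x) :
    x * gammaScalePdf α θ x = α * θ * gammaScalePdf (α + 1) θ x := by
  have hΓ := (Real.Gamma_pos_of_pos hα).ne'
  have hθα := (Real.rpow_pos_of_pos hθ α).ne'
  have hxα : x ^ α = x ^ (α - 1) * x := by
    rw [← Real.rpow_add_one hx.ne', sub_add_cancel]
  rw [gammaScalePdf, gammaScalePdf, Real.Gamma_add_one hα.ne', Real.rpow_add_one hθ.ne',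
    add_sub_cancel_right, hxα]
  field_simp

lemma integrableOn_gammaScalePdf {α θ : ℝ} (hα : 0 < α) (hθ : 0 < θ) :
    IntegrableOn (gammaScalePdf α θ) (Ioi 0) := by
  have h := integrableOn_rpow_mul_exp_neg_mul_rpow (s := α - 1) (p := 1) (b := θ⁻¹)
    (by linarith) one_pos (inv_pos.2 hθ)
  refine IntegrableOn.congr_fun (h.const_mul (Real.Gamma α * θ ^ α)⁻¹) (fun x _ => ?_)
    measurableSet_Ioi
  simp only [gammaScalePdf_eq_const_mul, Real.rpow_one, neg_mul]

lemma integral_gammaScalePdf {α θ : ℝ} (hα : 0 < α) (hθ : 0 < θ) :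
    ∫ x in Ioi (0 : ℝ), gammaScalePdf α θ x = 1 := by
  have hΓ := (Real.Gamma_pos_of_pos hα).ne'
  have hθα := (Real.rpow_pos_of_pos hθ α).ne'
  simp only [gammaScalePdf_eq_const_mul]
  rw [integral_const_mul, Real.integral_rpow_mul_exp_neg_mul_Ioi hα (inv_pos.2 hθ), one_div,
    inv_inv]
  field_simp

lemma abs_log_le_rpow_add_rpow_neg_div {x ε : ℝ} (hx : 0 < x) (hε : 0 < ε) :
    |Real.log x| ≤ (x ^ ε + x ^ (-ε)) / ε := by
  have h₁ := Real.log_le_rpow_div hx.le hε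
  have h₂ := Real.log_le_rpow_div (inv_pos.2 hx).le hε
  rw [Real.log_inv, Real.inv_rpow hx.le, ← Real.rpow_neg hx.le] at h₂
  have h₃ : 0 ≤ x ^ ε / ε := by positivity
  have h₄ : 0 ≤ x ^ (-ε) / ε := by positivity
  rw [add_div, abs_le]
  constructor <;> linarith

lemma integrableOn_log_mul_gammaScalePdf {α θ : ℝ} (hα : 0 < α) (hθ : 0 < θ) :
    IntegrableOn (fun x => Real.log x * gammaScalePdf α θ x) (Ioi 0) := by
  have h (s : ℝ) (hs : -1 < s) :
      IntegrableOn (fun x : ℝ => x ^ s * Real.exp (-(θ⁻¹ * x))) (Ioi 0) := by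
    simpa only [Real.rpow_one, neg_mul] using
      integrableOn_rpow_mul_exp_neg_mul_rpow (p := 1) hs one_pos (inv_pos.2 hθ)
  have hbound := ((h (α / 2 + (α - 1)) (by linarith)).add
    (h (-(α / 2) + (α - 1)) (by linarith))).const_mul ((Real.Gamma α * θ ^ α)⁻¹ / (α / 2))
  refine Integrable.mono' hbound
    (Real.measurable_log.aestronglyMeasurable.mul
      (integrableOn_gammaScalePdf hα hθ).aestronglyMeasurable) ?_
  refine (ae_restrict_iff' measurableSet_Ioi).2 (ae_of_all _ fun x (hx : 0 < x) => ?_)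
  have hpos := gammaScalePdf_pos hα hθ hx
  rw [Real.norm_eq_abs, abs_mul, abs_of_pos hpos]
  refine (mul_le_mul_of_nonneg_right
    (abs_log_le_rpow_add_rpow_neg_div hx (half_pos hα)) hpos.le).trans_eq ?_
  simp only [Pi.add_apply]
  rw [gammaScalePdf_eq_const_mul, Real.rpow_add hx, Real.rpow_add hx]
  ring

lemma integral_log_mul_gammaScalePdf_add_one {α θ : ℝ} (hα : 0 < α) (hθ : 0 < θ) :
    ∫ x in Ioi (0 : ℝ), Real.log x * gammaScalePdf (α + 1) θ x =
      (∫ x in Ioi (0 : ℝ), Real.log x * gammaScalePdf α θ x) + 1 / α := by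
  have hα₁ : 0 < α + 1 := by linarith
  have hlog := integrableOn_log_mul_gammaScalePdf hα hθ
  have hlog₁ := integrableOn_log_mul_gammaScalePdf hα₁ hθ
  have hpdf := integrableOn_gammaScalePdf hα hθ
  set g : ℝ → ℝ := fun x => Real.log x * gammaScalePdf (α + 1) θ x
  have hg₀ : g 0 = 0 := by simp [g]
  have hΓ := (Real.Gamma_pos_of_pos hα).ne'
  have hθα := (Real.rpow_pos_of_pos hθ α).ne'
  have hderiv (x : ℝ) (hx : x ∈ Ioi (0 : ℝ)) : HasDerivAt g
      (θ⁻¹ * (α⁻¹ * gammaScalePdf α θ x + Real.log x * gammaScalePdf α θ x - g x)) x := by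
    have hx' : x ≠ 0 := (mem_Ioi.1 hx).ne'
    have hd := (Real.hasDerivAt_log hx').mul
      ((((Real.hasDerivAt_rpow_const (p := α + 1 - 1) (Or.inl hx')).mul
        (((hasDerivAt_id x).neg.div_const θ).exp)).div_const
          (Real.Gamma (α + 1) * θ ^ (α + 1))))
    refine hd.congr_deriv ?_
    have hxα : x ^ α = x ^ (α - 1) * x := by
      rw [← Real.rpow_add_one hx', sub_add_cancel]
    simp only [g, gammaScalePdf, Pi.mul_apply, Pi.neg_apply, id]
    rw [Real.Gamma_add_one hα.ne', Real.rpow_add_one hθ.ne', add_sub_cancel_right, hxα]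
    field_simp
    ring
  have hint : IntegrableOn (fun x =>
      θ⁻¹ * (α⁻¹ * gammaScalePdf α θ x + Real.log x * gammaScalePdf α θ x - g x)) (Ioi 0) :=
    (((hpdf.const_mul α⁻¹).add hlog).sub hlog₁).const_mul θ⁻¹
  have hcont : ContinuousWithinAt g (Ici 0) 0 := by
    rw [← continuousWithinAt_Ioi_iff_Ici]
    have h₁ := tendsto_log_mul_rpow_nhdsGT_zero hα
    have h₂ : Tendsto (fun x : ℝ => Real.exp (-x / θ) / (Real.Gamma (α + 1) * θ ^ (α + 1)))
        (𝓝[>] 0) (𝓝 (Real.exp (-0 / θ) / (Real.Gamma (α + 1) * θ ^ (α + 1)))) :=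
      (Continuous.tendsto (by fun_prop) 0).mono_left nhdsWithin_le_nhds
    have h₃ := h₁.mul h₂
    rw [zero_mul] at h₃
    rw [ContinuousWithinAt, hg₀]
    refine h₃.congr fun x => ?_
    simp only [g, gammaScalePdf, add_sub_cancel_right]
    ring
  have htop := tendsto_zero_of_hasDerivAt_of_integrableOn_Ioi hderiv hint hlog₁
  have key := integral_Ioi_of_hasDerivAt_of_tendsto hcont hderiv hint htop
  rw [integral_const_mul, integral_sub ((hpdf.const_mul α⁻¹).fun_add hlog) hlog₁,
    integral_add (hpdf.const_mul α⁻¹) hlog, integral_const_mul, integral_gammaScalePdf hα hθ,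
    hg₀, sub_zero, mul_eq_zero] at key
  have := key.resolve_left (inv_pos.2 hθ).ne'
  rw [one_div]
  linarith

lemma integral_quadratic_log_mul_gammaScalePdf {α θ : ℝ} (hα : 0 < α) (hθ : 0 < θ)
    (a b c d e : ℝ) :
    ∫ x in Ioi (0 : ℝ), (a + b * x + c * x ^ 2 + d * Real.log x + e * (x * Real.log x)) *
        gammaScalePdf α θ x =
      a + b * (α * θ) + c * (α * (α + 1) * θ ^ 2) +
        d * (∫ x in Ioi (0 : ℝ), Real.log x * gammaScalePdf α θ x) +
        e * (α * θ * (∫ x in Ioi (0 : ℝ), Real.log x * gammaScalePdf α θ x) + θ) := by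
  have hα₁ : 0 < α + 1 := by linarith
  have hα₂ : 0 < α + 1 + 1 := by linarith
  have i₀ := (integrableOn_gammaScalePdf hα hθ).const_mul a
  have i₁ := (integrableOn_gammaScalePdf hα₁ hθ).const_mul (b * (α * θ))
  have i₂ := (integrableOn_gammaScalePdf hα₂ hθ).const_mul (c * (α * (α + 1) * θ ^ 2))
  have i₃ := (integrableOn_log_mul_gammaScalePdf hα hθ).const_mul d
  have i₄ := (integrableOn_log_mul_gammaScalePdf hα₁ hθ).const_mul (e * (α * θ))
  have hcongr : EqOn (fun x => (a + b * x + c * x ^ 2 + d * Real.log x +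
        e * (x * Real.log x)) * gammaScalePdf α θ x)
      (fun x => a * gammaScalePdf α θ x + b * (α * θ) * gammaScalePdf (α + 1) θ x +
        c * (α * (α + 1) * θ ^ 2) * gammaScalePdf (α + 1 + 1) θ x +
        d * (Real.log x * gammaScalePdf α θ x) +
        e * (α * θ) * (Real.log x * gammaScalePdf (α + 1) θ x)) (Ioi 0) := by
    intro x hx
    have e₁ := mul_gammaScalePdf hα hθ hx
    have e₂ := mul_gammaScalePdf hα₁ hθ hx
    linear_combination (b + e * Real.log x + c * x) * e₁ + c * (α * θ) * e₂
  rw [setIntegral_congr_fun measurableSet_Ioi hcongr,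
    integral_add (((i₀.fun_add i₁).fun_add i₂).fun_add i₃) i₄,
    integral_add ((i₀.fun_add i₁).fun_add i₂) i₃, integral_add (i₀.fun_add i₁) i₂, integral_add i₀ i₁]
  simp only [integral_const_mul]
  rw [integral_gammaScalePdf hα hθ, integral_gammaScalePdf hα₁ hθ,
    integral_gammaScalePdf hα₂ hθ, integral_log_mul_gammaScalePdf_add_one hα hθ]
  field_simp

/-- The scores in a shape parameter and in `λ` are affine in `log x₁`, `log x₂` and `x₁ + x₂`;
this is the expectation of such a product when the logarithms have total weight one. -/
lemma integral_affine_log_mul_centered_sum {α₁ α₂ lam : ℝ} (h₁ : 0 < α₁) (h₂ : 0 < α₂)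
    (hlam : 0 < lam) (u v c K : ℝ) (huv : u + v = 1) :
    ∫ x₁ in Ioi (0 : ℝ), ∫ x₂ in Ioi (0 : ℝ),
      (u * Real.log x₁ + v * Real.log x₂ - (x₁ + x₂) / lam + c) * (K * (x₁ + x₂ - lam)) *
        (gammaScalePdf α₁ (lam / (α₁ + α₂)) x₁ * gammaScalePdf α₂ (lam / (α₁ + α₂)) x₂) = 0 := by
  have hs : 0 < α₁ + α₂ := add_pos h₁ h₂
  have hθ : 0 < lam / (α₁ + α₂) := div_pos hlam hs
  set θ := lam / (α₁ + α₂) with hθ_def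
  have hlam_eq : lam = θ * (α₁ + α₂) := by rw [hθ_def]; field_simp
  set M₂ := ∫ x in Ioi (0 : ℝ), Real.log x * gammaScalePdf α₂ θ x with hM₂
  have inner (x₁ : ℝ) : ∫ x₂ in Ioi (0 : ℝ),
      (u * Real.log x₁ + v * Real.log x₂ - (x₁ + x₂) / lam + c) * (K * (x₁ + x₂ - lam)) *
        (gammaScalePdf α₁ θ x₁ * gammaScalePdf α₂ θ x₂) =
      (K * ((c * (α₂ * θ - lam) - α₂ * (α₂ + 1) * θ ^ 2 / lam + α₂ * θ
            + v * (α₂ * θ * M₂ + θ) - v * lam * M₂) +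
          (c + 1 - 2 * (α₂ * θ) / lam + v * M₂) * x₁ + (-1 / lam) * x₁ ^ 2 +
          u * (α₂ * θ - lam) * Real.log x₁ + u * (x₁ * Real.log x₁))) *
        gammaScalePdf α₁ θ x₁ := by
    have h := integral_quadratic_log_mul_gammaScalePdf h₂ hθ
      ((u * Real.log x₁ - x₁ / lam + c) * (x₁ - lam))
      ((u * Real.log x₁ - x₁ / lam + c) - (x₁ - lam) / lam) (-1 / lam) (v * (x₁ - lam)) v
    rw [← hM₂] at h
    calc
      _ = ∫ x₂ in Ioi (0 : ℝ), (K * gammaScalePdf α₁ θ x₁) *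
            (((u * Real.log x₁ - x₁ / lam + c) * (x₁ - lam) +
              ((u * Real.log x₁ - x₁ / lam + c) - (x₁ - lam) / lam) * x₂ +
              (-1 / lam) * x₂ ^ 2 + v * (x₁ - lam) * Real.log x₂ + v * (x₂ * Real.log x₂)) *
              gammaScalePdf α₂ θ x₂) := by
        congr 1
        ext x₂
        ring
      _ = _ := by
        rw [integral_const_mul, h]
        field_simp
        ring
  simp only [inner, mul_assoc K]
  rw [integral_const_mul, integral_quadratic_log_mul_gammaScalePdf h₁ hθ]
  obtain rfl : u = 1 - v := by linarith
  clear_value M₂ θ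
  subst hlam_eq
  field_simp
  ring

lemma log_gammaScalePdf {α θ x : ℝ} (hα : 0 < α) (hθ : 0 < θ) (hx : 0 < x) :
    Real.log (gammaScalePdf α θ x) =
      (α - 1) * Real.log x - x / θ - (Real.log (Real.Gamma α) + α * Real.log θ) := by
  have hΓ := Real.Gamma_pos_of_pos hα
  rw [gammaScalePdf, Real.log_div (by positivity) (by positivity),
    Real.log_mul (by positivity) (by positivity), Real.log_mul (by positivity) (by positivity),
    Real.log_exp, Real.log_rpow hx, Real.log_rpow hθ]
  ring

lemma gammaLbar_eq {α₁ α₂ lam x₁ x₂ : ℝ} (h₁ : 0 < α₁) (h₂ : 0 < α₂) (hlam : 0 < lam)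
    (hx₁ : 0 < x₁) (hx₂ : 0 < x₂) :
    gammaLbar α₁ α₂ lam x₁ x₂ =
      (α₁ - 1) * Real.log x₁ + (α₂ - 1) * Real.log x₂ - (x₁ + x₂) * (α₁ + α₂) / lam -
        Real.log (Real.Gamma α₁) - Real.log (Real.Gamma α₂) -
        (α₁ + α₂) * (Real.log lam - Real.log (α₁ + α₂)) := by
  have hs : 0 < α₁ + α₂ := add_pos h₁ h₂
  have hθ : 0 < lam / (α₁ + α₂) := div_pos hlam hs
  rw [gammaLbar, log_gammaScalePdf h₁ hθ hx₁, log_gammaScalePdf h₂ hθ hx₂,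
    Real.log_div hlam.ne' hs.ne']
  field_simp
  ring

lemma gammaLbar_comm (α₁ α₂ lam x₁ x₂ : ℝ) :
    gammaLbar α₁ α₂ lam x₁ x₂ = gammaLbar α₂ α₁ lam x₂ x₁ := by
  rw [gammaLbar, gammaLbar, add_comm α₂ α₁, add_comm]

lemma exp_gammaLbar {α₁ α₂ lam x₁ x₂ : ℝ} (h₁ : 0 < α₁) (h₂ : 0 < α₂) (hlam : 0 < lam)
    (hx₁ : 0 < x₁) (hx₂ : 0 < x₂) :
    Real.exp (gammaLbar α₁ α₂ lam x₁ x₂) =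
      gammaScalePdf α₁ (lam / (α₁ + α₂)) x₁ * gammaScalePdf α₂ (lam / (α₁ + α₂)) x₂ := by
  have hθ : 0 < lam / (α₁ + α₂) := div_pos hlam (add_pos h₁ h₂)
  rw [gammaLbar, Real.exp_add, Real.exp_log (gammaScalePdf_pos h₁ hθ hx₁),
    Real.exp_log (gammaScalePdf_pos h₂ hθ hx₂)]

lemma hasDerivAt_gammaLbar_scale {α₁ α₂ lam x₁ x₂ : ℝ} (h₁ : 0 < α₁) (h₂ : 0 < α₂)
    (hlam : 0 < lam) (hx₁ : 0 < x₁) (hx₂ : 0 < x₂) :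
    HasDerivAt (fun L => gammaLbar α₁ α₂ L x₁ x₂)
      ((α₁ + α₂) / lam ^ 2 * (x₁ + x₂ - lam)) lam := by
  have hd := (((((hasDerivAt_inv hlam.ne').const_mul ((x₁ + x₂) * (α₁ + α₂))).const_sub
    ((α₁ - 1) * Real.log x₁ + (α₂ - 1) * Real.log x₂)).sub_const
      (Real.log (Real.Gamma α₁))).sub_const (Real.log (Real.Gamma α₂))).sub
      (((Real.hasDerivAt_log hlam.ne').sub_const (Real.log (α₁ + α₂))).const_mul (α₁ + α₂))
  refine (hd.congr_of_eventuallyEq ?_).congr_deriv ?_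
  · filter_upwards [Ioi_mem_nhds hlam] with L hL
    rw [gammaLbar_eq h₁ h₂ hL hx₁ hx₂, div_eq_mul_inv]
    rfl
  · field_simp

lemma hasDerivAt_gammaLbar_shape {α₁ α₂ lam x₁ x₂ : ℝ} (h₁ : 0 < α₁) (h₂ : 0 < α₂)
    (hlam : 0 < lam) (hx₁ : 0 < x₁) (hx₂ : 0 < x₂) :
    HasDerivAt (fun a => gammaLbar a α₂ lam x₁ x₂)
      (Real.log x₁ - (x₁ + x₂) / lam +
        (1 - deriv Real.Gamma α₁ / Real.Gamma α₁ - Real.log lam + Real.log (α₁ + α₂))) α₁ := by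
  have hs : 0 < α₁ + α₂ := add_pos h₁ h₂
  have hΓ : HasDerivAt (fun a => Real.log (Real.Gamma a))
      (deriv Real.Gamma α₁ / Real.Gamma α₁) α₁ :=
    (Real.differentiableAt_Gamma fun m => by
      have : (0 : ℝ) ≤ m := m.cast_nonneg
      linarith).hasDerivAt.log (Real.Gamma_pos_of_pos h₁).ne'
  have hsum := (hasDerivAt_id α₁).add_const α₂
  have hd := (((((((hasDerivAt_id α₁).sub_const 1).mul_const (Real.log x₁)).add_const
    ((α₂ - 1) * Real.log x₂)).sub ((hsum.const_mul (x₁ + x₂)).div_const lam)).sub hΓ).sub_const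
      (Real.log (Real.Gamma α₂))).sub (hsum.mul ((hsum.log hs.ne').const_sub (Real.log lam)))
  refine (hd.congr_of_eventuallyEq ?_).congr_deriv ?_
  · filter_upwards [Ioi_mem_nhds h₁] with a ha
    rw [gammaLbar_eq ha h₂ hlam hx₁ hx₂]
    rfl
  · simp only [id]
    field_simp
    ring

/-- For two independent Gamma samples sharing the scale `θ`, the reparameterization
`λ = θ(α₁ + α₂)` makes the shape parameters `α₁` and `α₂` globally orthogonal
to `λ`. -/
theorem stmt12 (α₁ α₂ lam : ℝ) (h₁ : 0 < α₁) (h₂ : 0 < α₂) (hlam : 0 < lam) :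
    (∫ x₁ in Set.Ioi (0 : ℝ), ∫ x₂ in Set.Ioi (0 : ℝ),
        deriv (fun a => gammaLbar a α₂ lam x₁ x₂) α₁ *
          deriv (fun L => gammaLbar α₁ α₂ L x₁ x₂) lam *
          Real.exp (gammaLbar α₁ α₂ lam x₁ x₂) = 0) ∧
    (∫ x₁ in Set.Ioi (0 : ℝ), ∫ x₂ in Set.Ioi (0 : ℝ),
        deriv (fun a => gammaLbar α₁ a lam x₁ x₂) α₂ *
          deriv (fun L => gammaLbar α₁ α₂ L x₁ x₂) lam *
          Real.exp (gammaLbar α₁ α₂ lam x₁ x₂) = 0) := by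
  constructor
  · refine Eq.trans ?_ (integral_affine_log_mul_centered_sum h₁ h₂ hlam 1 0
      (1 - deriv Real.Gamma α₁ / Real.Gamma α₁ - Real.log lam + Real.log (α₁ + α₂))
      ((α₁ + α₂) / lam ^ 2) (add_zero 1))
    refine setIntegral_congr_fun measurableSet_Ioi fun x₁ hx₁ =>
      setIntegral_congr_fun measurableSet_Ioi fun x₂ hx₂ => ?_
    simp only [(hasDerivAt_gammaLbar_shape h₁ h₂ hlam hx₁ hx₂).deriv,
      (hasDerivAt_gammaLbar_scale h₁ h₂ hlam hx₁ hx₂).deriv, exp_gammaLbar h₁ h₂ hlam hx₁ hx₂]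
    ring
  · refine Eq.trans ?_ (integral_affine_log_mul_centered_sum h₁ h₂ hlam 0 1
      (1 - deriv Real.Gamma α₂ / Real.Gamma α₂ - Real.log lam + Real.log (α₂ + α₁))
      ((α₁ + α₂) / lam ^ 2) (zero_add 1))
    refine setIntegral_congr_fun measurableSet_Ioi fun x₁ hx₁ =>
      setIntegral_congr_fun measurableSet_Ioi fun x₂ hx₂ => ?_
    have hshape := (hasDerivAt_gammaLbar_shape h₂ h₁ hlam hx₂ hx₁).deriv
    simp only [gammaLbar_comm _ α₁] at hshape
    simp only [hshape, (hasDerivAt_gammaLbar_scale h₁ h₂ hlam hx₁ hx₂).deriv,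
      exp_gammaLbar h₁ h₂ hlam hx₁ hx₂]
    ring
end
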